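/- Suppose the operator L satisfies the positive maximum principle on M₊(E). Then b₁ satisfies the positive minimum principle on E: for every g ∈ C(E) with g ≥ 0 and every x ∈ E with g(x) = 0, one has b₁g(x) ≥ 0. -/

import Mathlib

open MeasureTheory Topology

/-- The topological support of a measure: points all of whose open neighborhoods
have positive measure. -/
def mSupport {E : Type*} [TopologicalSpace E] [MeasurableSpace E]
    (ν : Measure E) : Set E :=
  {x : E | ∀ U : Set E, IsOpen U → x ∈ U → 0 < ν U}

/-- The action of the operator `L` (with parameters `b₀, b₁, q₀, q₁, q₂`) on the cylindrical
function `ν ↦ φ(⟨g₁,ν⟩, …, ⟨g_m,ν⟩)`, evaluated at `ν`. -/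
noncomputable def Lapp {E : Type*} [MetricSpace E] [MeasurableSpace E]
    (b₀ : C(E, ℝ) →ₗ[ℝ] ℝ) (b₁ : C(E, ℝ) →ₗ[ℝ] C(E, ℝ))
    (q₀ : C(E, ℝ) →ₗ[ℝ] C(E, ℝ) →ₗ[ℝ] ℝ)
    (q₁ : C(E, ℝ) →ₗ[ℝ] C(E, ℝ) →ₗ[ℝ] C(E, ℝ))
    (q₂ : C(E, ℝ) →ₗ[ℝ] C(E, ℝ) →ₗ[ℝ] C(E × E, ℝ))
    (m : ℕ) (φ : (Fin m → ℝ) → ℝ) (g : Fin m → C(E, ℝ)) (ν : FiniteMeasure E) : ℝ :=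
  (∑ i, fderiv ℝ φ (fun k => ∫ x, g k x ∂(ν : Measure E)) (Pi.single i 1) *
      (b₀ (g i) + ∫ x, b₁ (g i) x ∂(ν : Measure E))) +
  (1 / 2) * ∑ i, ∑ j,
    (fderiv ℝ (fun w => fderiv ℝ φ w (Pi.single i 1))
        (fun k => ∫ x, g k x ∂(ν : Measure E)) (Pi.single j 1)) *
      (q₀ (g i) (g j) + (∫ x, q₁ (g i) (g j) x ∂(ν : Measure E)) +
        ∫ p, q₂ (g i) (g j) p ∂((ν : Measure E).prod (ν : Measure E)))

/-- `φ : ℝ^m → ℝ` is a polynomial function. -/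
def IsPolyFn {m : ℕ} (φ : (Fin m → ℝ) → ℝ) : Prop :=
  ∃ P : MvPolynomial (Fin m) ℝ, ∀ v, φ v = MvPolynomial.eval v P

/-- The operator `L` satisfies the positive maximum principle on `M₊(E)`: for every
cylindrical function `f(ν) = φ(⟨g₁,ν⟩, …, ⟨g_m,ν⟩)` whose outer function `φ` is smooth and
either a polynomial or compactly supported, and every global maximizer `ν*` of `f` over
`M₊(E)` with `f(ν*) ≥ 0`, one has `Lf(ν*) ≤ 0`. -/
def SatisfiesPMP {E : Type*} [MetricSpace E] [MeasurableSpace E]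
    (b₀ : C(E, ℝ) →ₗ[ℝ] ℝ) (b₁ : C(E, ℝ) →ₗ[ℝ] C(E, ℝ))
    (q₀ : C(E, ℝ) →ₗ[ℝ] C(E, ℝ) →ₗ[ℝ] ℝ)
    (q₁ : C(E, ℝ) →ₗ[ℝ] C(E, ℝ) →ₗ[ℝ] C(E, ℝ))
    (q₂ : C(E, ℝ) →ₗ[ℝ] C(E, ℝ) →ₗ[ℝ] C(E × E, ℝ)) : Prop :=
  ∀ (m : ℕ) (φ : (Fin m → ℝ) → ℝ), ContDiff ℝ (⊤ : ℕ∞) φ →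
    (IsPolyFn φ ∨ HasCompactSupport φ) →
    ∀ (g : Fin m → C(E, ℝ)) (νstar : FiniteMeasure E),
      (∀ ν : FiniteMeasure E,
        φ (fun i => ∫ x, g i x ∂(ν : Measure E)) ≤
          φ (fun i => ∫ x, g i x ∂(νstar : Measure E))) →
      0 ≤ φ (fun i => ∫ x, g i x ∂(νstar : Measure E)) →
      Lapp b₀ b₁ q₀ q₁ q₂ m φ g νstar ≤ 0

/-- The action of `L` on the linear cylindrical function `ν ↦ -⟨g,ν⟩` involves only the
first-order part of `L`. -/
theorem Lapp_neg_linear {E : Type*} [MetricSpace E] [MeasurableSpace E]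
    (b₀ : C(E, ℝ) →ₗ[ℝ] ℝ) (b₁ : C(E, ℝ) →ₗ[ℝ] C(E, ℝ))
    (q₀ : C(E, ℝ) →ₗ[ℝ] C(E, ℝ) →ₗ[ℝ] ℝ)
    (q₁ : C(E, ℝ) →ₗ[ℝ] C(E, ℝ) →ₗ[ℝ] C(E, ℝ))
    (q₂ : C(E, ℝ) →ₗ[ℝ] C(E, ℝ) →ₗ[ℝ] C(E × E, ℝ))
    (g : C(E, ℝ)) (ν : FiniteMeasure E) :
    Lapp b₀ b₁ q₀ q₁ q₂ 1 (fun v => -v 0) (fun _ => g) ν =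
      -(b₀ g + ∫ x, b₁ g x ∂(ν : Measure E)) := by
  have hd (w : Fin 1 → ℝ) : fderiv ℝ (fun v : Fin 1 → ℝ => -v 0) w =
      -ContinuousLinearMap.proj (R := ℝ) (φ := fun _ : Fin 1 => ℝ) 0 :=
    (-ContinuousLinearMap.proj (R := ℝ) (φ := fun _ : Fin 1 => ℝ) 0).fderiv
  simp only [Lapp, hd]
  simp

/-- Under the positive maximum principle, the drift of `⟨g,ν⟩` is nonnegative at every multiple
of a Dirac mass at a zero of `g ≥ 0`. -/
theorem SatisfiesPMP.drift_smul_dirac_nonneg {E : Type*} [MetricSpace E] [MeasurableSpace E]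
    [BorelSpace E]
    {b₀ : C(E, ℝ) →ₗ[ℝ] ℝ} {b₁ : C(E, ℝ) →ₗ[ℝ] C(E, ℝ)}
    {q₀ : C(E, ℝ) →ₗ[ℝ] C(E, ℝ) →ₗ[ℝ] ℝ}
    {q₁ : C(E, ℝ) →ₗ[ℝ] C(E, ℝ) →ₗ[ℝ] C(E, ℝ)}
    {q₂ : C(E, ℝ) →ₗ[ℝ] C(E, ℝ) →ₗ[ℝ] C(E × E, ℝ)}
    (hPMP : SatisfiesPMP b₀ b₁ q₀ q₁ q₂) {g : C(E, ℝ)} (hg : ∀ x, 0 ≤ g x)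
    {x : E} (hx : g x = 0) (c : NNReal) : 0 ≤ b₀ g + c * b₁ g x := by
  let ν : FiniteMeasure E := c • ⟨Measure.dirac x, inferInstance⟩
  have hν (h : C(E, ℝ)) : ∫ y, h y ∂(ν : Measure E) = c * h x := by
    have : (ν : Measure E) = c • Measure.dirac x := rfl
    rw [this, integral_smul_nnreal_measure, integral_dirac, NNReal.smul_def, smul_eq_mul]
  have key := hPMP 1 (fun v => -v 0) (by fun_prop) (.inl ⟨-MvPolynomial.X 0, by simp⟩)
    (fun _ => g) ν (fun μ => by simpa [hν, hx] using integral_nonneg hg) (by simp [hν, hx])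
  rw [Lapp_neg_linear, hν] at key
  linarith

/-- If `L` satisfies the positive maximum principle on `M₊(E)`, then `b₁` satisfies the
positive minimum principle on `E`. -/
theorem stmt_9 {E : Type*} [MetricSpace E] [CompactSpace E] [MeasurableSpace E] [BorelSpace E]
    (b₀ : C(E, ℝ) →ₗ[ℝ] ℝ) (b₁ : C(E, ℝ) →ₗ[ℝ] C(E, ℝ))
    (q₀ : C(E, ℝ) →ₗ[ℝ] C(E, ℝ) →ₗ[ℝ] ℝ)
    (q₁ : C(E, ℝ) →ₗ[ℝ] C(E, ℝ) →ₗ[ℝ] C(E, ℝ))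
    (q₂ : C(E, ℝ) →ₗ[ℝ] C(E, ℝ) →ₗ[ℝ] C(E × E, ℝ))
    (hq₀ : ∀ g h : C(E, ℝ), q₀ g h = q₀ h g)
    (hq₁ : ∀ g h : C(E, ℝ), q₁ g h = q₁ h g)
    (hq₂ : ∀ g h : C(E, ℝ), q₂ g h = q₂ h g)
    (hq₂val : ∀ (g h : C(E, ℝ)) (x y : E), q₂ g h (x, y) = q₂ g h (y, x))
    (hPMP : SatisfiesPMP b₀ b₁ q₀ q₁ q₂) :
    ∀ g : C(E, ℝ), (∀ x, 0 ≤ g x) → ∀ x : E, g x = 0 → 0 ≤ b₁ g x := by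
  intro g hg x hx
  by_contra! hneg
  obtain ⟨n, hn⟩ := exists_nat_gt (b₀ g / -b₁ g x)
  rw [div_lt_iff₀ (neg_pos.2 hneg)] at hn
  have := hPMP.drift_smul_dirac_nonneg hg hx n
  push_cast at this
  linarith
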